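/- Let β be a non-increasing weight sequence, X, U, Y complex Hilbert spaces, T ∈ L(X), E ∈ L(X,Y), N ∈ L(X,U), with (E,T) β-output stable and (N,T) 1-output stable. For x ∈ X set p(x) = Σ_{j≥0} β_j^{-1} ‖E T^j x‖² − Σ_{j≥0} ‖N T^j x‖². Then for every x ∈ X all the series involved converge and p(x) − p(Tx) = Σ_{j≥0} c_j ‖E T^j x‖² − ‖N x‖² (the Stein identity P − T*PT = Õ*Õ − N*N in quadratic form). -/

import Mathlib

open Metric Filter

noncomputable section

/-- `β` is a weight sequence: positive, `β 0 = 1`, and `liminf β_j^(1/j) ≥ 1`. -/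
def IsWeightSeq (β : ℕ → ℝ) : Prop :=
  (∀ j, 0 < β j) ∧ β 0 = 1 ∧
    1 ≤ Filter.liminf (fun j : ℕ => β j ^ ((1 : ℝ) / j)) Filter.atTop

/-- The pair `(E,T)` is `β`-output stable. -/
def OutputStable {X Y : Type*} [NormedAddCommGroup X] [InnerProductSpace ℂ X]
    [NormedAddCommGroup Y] [InnerProductSpace ℂ Y]
    (β : ℕ → ℝ) (E : X →L[ℂ] Y) (T : X →L[ℂ] X) : Prop :=
  ∃ C : ℝ, 0 ≤ C ∧ ∀ x : X,
    Summable (fun j => (β j)⁻¹ * ‖E ((T ^ j) x)‖ ^ 2) ∧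
    ∑' j, (β j)⁻¹ * ‖E ((T ^ j) x)‖ ^ 2 ≤ C * ‖x‖ ^ 2

/-- Summation by parts behind the Stein identity: if `c 0 = b 0` and `c (j + 1) = b (j + 1) - b j`,
then `∑ c j * a j = ∑ b j * a j - ∑ b j * a (j + 1)`. -/
theorem hasSum_diff_mul {a b c : ℕ → ℝ} (hc0 : c 0 = b 0) (hcs : ∀ j, c (j + 1) = b (j + 1) - b j)
    (h : Summable fun j => b j * a j) (h' : Summable fun j => b j * a (j + 1)) :
    HasSum (fun j => c j * a j) (∑' j, b j * a j - ∑' j, b j * a (j + 1)) := by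
  have hshift := ((hasSum_nat_add_iff' 1).2 h.hasSum).sub h'.hasSum
  rw [← hasSum_nat_add_iff' 1]
  convert hshift using 1
  · funext j
    rw [hcs]
    ring
  · simp only [Finset.sum_range_one, hc0]
    ring

theorem stmt17 {X U Y : Type*}
    [NormedAddCommGroup X] [InnerProductSpace ℂ X] [CompleteSpace X]
    [NormedAddCommGroup U] [InnerProductSpace ℂ U] [CompleteSpace U]
    [NormedAddCommGroup Y] [InnerProductSpace ℂ Y] [CompleteSpace Y]
    (β : ℕ → ℝ) (hβ : IsWeightSeq β) (hmono : ∀ j, β (j + 1) ≤ β j)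
    (c : ℕ → ℝ) (hc0 : c 0 = 1) (hcs : ∀ j, c (j + 1) = (β (j + 1))⁻¹ - (β j)⁻¹)
    (T : X →L[ℂ] X) (E : X →L[ℂ] Y) (N : X →L[ℂ] U)
    (hET : OutputStable β E T) (hNT : OutputStable (fun _ => 1) N T)
    -- `p` is the quadratic form of the Pick operator `P = G_{β,E,T} - G_{1,N,T}`
    (p : X → ℝ)
    (hp : ∀ x : X, p x = (∑' j, (β j)⁻¹ * ‖E ((T ^ j) x)‖ ^ 2)
      - ∑' j, ‖N ((T ^ j) x)‖ ^ 2) :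
    ∀ x : X,
      Summable (fun j => c j * ‖E ((T ^ j) x)‖ ^ 2) ∧
      p x - p (T x) = (∑' j, c j * ‖E ((T ^ j) x)‖ ^ 2) - ‖N x‖ ^ 2 := by
  intro x
  have hpow (j : ℕ) : (T ^ j) (T x) = (T ^ (j + 1)) x := by
    rw [pow_succ, mul_apply_eq_comp]
  obtain ⟨_, _, hE⟩ := hET
  obtain ⟨_, _, hN⟩ := hNT
  have hNx := (hN x).1
  have hETx := (hE (T x)).1
  simp only [inv_one, one_mul] at hNx
  simp only [hpow] at hETx
  have hsum := hasSum_diff_mul (a := fun j => ‖E ((T ^ j) x)‖ ^ 2) (b := fun j => (β j)⁻¹)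
    (by simp [hc0, hβ.2.1]) hcs (hE x).1 hETx
  refine ⟨hsum.summable, ?_⟩
  rw [hp, hp, hsum.tsum_eq, hNx.tsum_eq_zero_add]
  simp only [hpow, pow_zero, one_apply_eq_self]
  ring
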